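/- Let (ℛ,≤,r) be a strong topological Ramsey space with its Ellentuck topology. For any 𝒳 ⊆ ℛ, the following are equivalent: (a) 𝒳 is Ramsey null; (b) 𝒳 is nowhere dense; (c) 𝒳 is meager. -/

import Mathlib

open scoped Topology

namespace AbstractTRS

/-- A combinatorial structure `(ℛ, ≤, r)`: a quasi-ordered set `R` of objects together with
approximation mappings `r : R → ℕ → α` and a finitization relation `≤_fin` on approximations. -/
structure CombStruct (R : Type) (α : Type) where
  le : R → R → Prop
  le_refl : ∀ A, le A A
  le_trans : ∀ {A B C}, le A B → le B C → le A C
  r : R → ℕ → α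
  lefin : α → α → Prop

namespace CombStruct

variable {R α : Type} (S : CombStruct R α)

/-- `𝒜ℛ`, the set of all finite approximations. -/
def AR : Set α := {a | ∃ (A : R) (n : ℕ), S.r A n = a}

/-- `𝒜ℛ_n`, the set of all `n`-approximations. -/
def ARn (n : ℕ) : Set α := {a | ∃ A : R, S.r A n = a}

/-- `a ⊑ b` : `a` is an initial segment of `b`. -/
def Init (a b : α) : Prop := ∃ (C : R) (n m : ℕ), n ≤ m ∧ S.r C n = a ∧ S.r C m = b

/-- `a ⊏ b` : `a` is a proper initial segment of `b`. -/
def PInit (a b : α) : Prop := S.Init a b ∧ a ≠ b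

/-- The basic set `[a, B]`, where `na = |a|` is the length of `a`. -/
def seg (a : α) (na : ℕ) (B : R) : Set R := {X | S.le X B ∧ S.r X na = a}

/-- `[n, B] = [r_n(B), B]`. -/
def segN (n : ℕ) (B : R) : Set R := S.seg (S.r B n) n B

/-- `depth_B(a) < ∞`. -/
def hasDepth (B : R) (a : α) : Prop := ∃ n, S.lefin a (S.r B n)

/-- `depth_B(a)` : the minimal `n` with `a ≤_fin r_n(B)` (junk value `0` if there is none). -/
noncomputable def depth (B : R) (a : α) : ℕ :=
  letI : DecidablePred fun n => S.lefin a (S.r B n) := Classical.decPred _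
  letI : Decidable (∃ n, S.lefin a (S.r B n)) := Classical.dec _
  if h : ∃ n, S.lefin a (S.r B n) then Nat.find h else 0

/-- `r_n''[a,B]`, where `na = |a|`. -/
def rimg (n : ℕ) (a : α) (na : ℕ) (B : R) : Set α :=
  {d | ∃ D ∈ S.seg a na B, S.r D n = d}

/-- Axioms A.1 (metrization). -/
def A1 : Prop :=
  (∀ A B : R, S.r A 0 = S.r B 0) ∧
  (∀ A B : R, A ≠ B → ∃ n, S.r A n ≠ S.r B n) ∧
  (∀ (A B : R) (n m : ℕ), S.r A n = S.r B m → n = m ∧ ∀ k ≤ n, S.r A k = S.r B k)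

/-- Axioms A.2 (finitization): `≤_fin` is a quasi-order on `𝒜ℛ` satisfying A.2.1–A.2.3. -/
def A2 : Prop :=
  (∀ a ∈ S.AR, S.lefin a a) ∧
  (∀ a b c : α, S.lefin a b → S.lefin b c → S.lefin a c) ∧
  (∀ b : α, {a : α | S.lefin a b}.Finite) ∧
  (∀ A B : R, S.le A B ↔ ∀ n : ℕ, ∃ m : ℕ, S.lefin (S.r A n) (S.r B m)) ∧
  (∀ a b c : α, S.Init a b → S.lefin b c → ∃ d : α, S.Init d c ∧ S.lefin a d)

/-- Axioms A.3 (amalgamation). -/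
def A3 : Prop :=
  (∀ (a : α) (na : ℕ), a ∈ S.ARn na → ∀ B : R, S.hasDepth B a →
    ∀ A ∈ S.segN (S.depth B a) B, (S.seg a na A).Nonempty) ∧
  (∀ (a : α) (na : ℕ), a ∈ S.ARn na → ∀ A B : R, S.le A B →
    S.hasDepth B a → S.hasDepth A a → S.depth A a ≤ S.depth B a →
    ∃ A' ∈ S.segN (S.depth B a) B, S.seg a na A' ⊆ S.seg a na A)

/-- Axiom A.4 (abstract pigeonhole principle). -/
def A4 : Prop :=
  ∀ (a : α) (na : ℕ), a ∈ S.ARn na → ∀ B : R, S.hasDepth B a →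
    ∀ O : Set α, O ⊆ S.ARn (na + 1) →
      ∃ A ∈ S.segN (S.depth B a) B,
        S.rimg (na + 1) a na A ⊆ O ∨ O ∩ S.rimg (na + 1) a na A = ∅

/-- `⟨b,B⟩_m^A = {X ∈ [b,B] : depth_A(r_{|b|+1}(X)) > m}`, where `nb = |b|`. -/
def angle (b : α) (nb : ℕ) (B A : R) (m : ℕ) : Set R :=
  {X | X ∈ S.seg b nb B ∧ (S.hasDepth A (S.r X (nb + 1)) → m < S.depth A (S.r X (nb + 1)))}

/-- Axiom A.3*.1 (first axiom of strong amalgamation). -/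
def A3star1 : Prop :=
  ∀ (b : α) (nb : ℕ), b ∈ S.ARn nb → ∀ (A : R) (m : ℕ),
    S.hasDepth A b → S.depth A b ≤ m →
    ∀ B ∈ S.segN m A, (S.angle b nb B A m).Nonempty

/-- Axiom A.3*.2 (second axiom of strong amalgamation). -/
def A3star2 : Prop :=
  ∀ (b : α) (nb : ℕ), b ∈ S.ARn nb → ∀ (A B : R) (m : ℕ), S.le B A →
    S.hasDepth A b → S.depth A b ≤ m → S.hasDepth B b → S.depth B b ≤ S.depth A b →
    ∃ B' ∈ S.segN m A, S.angle b nb B' A m ⊆ S.angle b nb B A m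

/-- Axioms A.3* (strong amalgamation). -/
def A3star : Prop := S.A3star1 ∧ S.A3star2

/-- The structure is metrically closed: `ℛ`, identified with the set of sequences
`(r_n(A))_n`, is closed in `α^ℕ` with `α` discrete. -/
def MetricallyClosed : Prop :=
  @IsClosed (ℕ → α) (@Pi.topologicalSpace ℕ (fun _ => α) (fun _ => ⊥))
    {f | ∃ A : R, ∀ n, f n = S.r A n}

/-- The basic (open) sets `[a,B]` of the Ellentuck topology. -/
def IsBasic (U : Set R) : Prop :=
  ∃ (a : α) (na : ℕ) (B : R), a ∈ S.ARn na ∧ U = S.seg a na B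

/-- The Ellentuck topology on `ℛ`, generated by the basic sets `[a,B]`. -/
def ellentuck : TopologicalSpace R :=
  TopologicalSpace.generateFrom {U | S.IsBasic U}

/-- `(ℛ,≤,r)` is a topological Ramsey space. -/
def IsTRS : Prop := S.MetricallyClosed ∧ S.A1 ∧ S.A2 ∧ S.A3 ∧ S.A4

/-- `(ℛ,≤,r)` is a strong topological Ramsey space. -/
def IsStrongTRS : Prop := S.MetricallyClosed ∧ S.A1 ∧ S.A2 ∧ S.A3star ∧ S.A4

/-- `𝒳 ⊆ ℛ` is Ramsey. -/
def RamseySet (X : Set R) : Prop :=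
  ∀ (a : α) (na : ℕ) (A : R), a ∈ S.ARn na → (S.seg a na A).Nonempty →
    ∃ B ∈ S.seg a na A, S.seg a na B ⊆ X ∨ S.seg a na B ∩ X = ∅

/-- `𝒳 ⊆ ℛ` is Ramsey null. -/
def RamseyNull (X : Set R) : Prop :=
  ∀ (a : α) (na : ℕ) (A : R), a ∈ S.ARn na → (S.seg a na A).Nonempty →
    ∃ B ∈ S.seg a na A, S.seg a na B ∩ X = ∅

/-- `𝒳` is nowhere dense (with respect to the basis of the Ellentuck topology). -/
def NwdB (X : Set R) : Prop :=
  ∀ U : Set R, S.IsBasic U → U.Nonempty →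
    ∃ V : Set R, S.IsBasic V ∧ V.Nonempty ∧ V ⊆ U ∧ V ∩ X = ∅

/-- `𝒳` is meager: a countable union of nowhere dense sets. -/
def MeagerB (X : Set R) : Prop :=
  ∃ f : ℕ → Set R, (∀ i, S.NwdB (f i)) ∧ X = ⋃ i, f i

/-- `𝒳` has the abstract Baire property. -/
def ABP (X : Set R) : Prop :=
  ∀ U : Set R, S.IsBasic U → U.Nonempty →
    ∃ V : Set R, S.IsBasic V ∧ V.Nonempty ∧ V ⊆ U ∧ (V ⊆ X ∨ V ∩ X = ∅)

/-- `𝒳` has the Baire property: `𝒳 △ 𝒪` is meager for some open set `𝒪`. -/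
def BP (X : Set R) : Prop :=
  ∃ O : Set R, IsOpen[S.ellentuck] O ∧ S.MeagerB (symmDiff X O)

/-- `ℛ ↾ H = {A ∈ ℛ : A ≤ H}`. -/
def restrict (H : R) : Set R := {A | S.le A H}

/-- `𝒮_b^𝒬 = {D ∈ ℛ : ∅ ≠ [b,D] ⊆ 𝒬}`, where `nb = |b|`. -/
def Sb (Q : Set R) (b : α) (nb : ℕ) : Set R :=
  {D | (S.seg b nb D).Nonempty ∧ S.seg b nb D ⊆ Q}

/-- `D∞` is a diagonalization of the sequence `{D_n}` inside `[a,B]`: for every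
`b ∈ 𝒜ℛ↾[a,D∞]` (with `|b| = nb`) one has `∅ ≠ [b,D∞] ⊆ [b,D_{n_b}]`,
where `n_b = depth_B(b) - depth_B(a)`. -/
def Diag (a : α) (B : R) (D : ℕ → R) (Dinf : R) : Prop :=
  ∀ (b : α) (nb : ℕ), b ∈ S.ARn nb → S.Init a b → S.hasDepth Dinf b →
    (S.seg b nb Dinf).Nonempty ∧
    S.seg b nb Dinf ⊆ S.seg b nb (D (S.depth B b - S.depth B a))

/-- The space is selective: decreasing sequences inside nonempty basic sets admit
diagonalizations. -/
def Selective : Prop :=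
  ∀ (a : α) (na : ℕ) (B : R), a ∈ S.ARn na → (S.seg a na B).Nonempty →
    ∀ D : ℕ → R, (∀ n, D n ∈ S.seg a na B) → (∀ n, S.le (D (n + 1)) (D n)) →
      ∃ Dinf ∈ S.seg a na B, S.Diag a B D Dinf

/-! ### The abstract Kastanas game `𝒢_{[a₀,B₀]}(𝒳)`

Player I plays objects `A 0, A 1, A 2, …` (the paper's `A₁, A₂, …`) and player II answers
with basic sets `[ak (k+1), Bk (k+1)]` (the paper's `[a₁,B₁], [a₂,B₂], …`), where
`ak 0 = a₀` and `Bk 0 = B₀`; `na = |a₀|`, so `|ak k| = na + k`. -/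

/-- The moves of player I induced by a strategy `σ` (which sees II's previous moves). -/
def playI (σ : List (α × R) → R) (ak : ℕ → α) (Bk : ℕ → R) (k : ℕ) : R :=
  σ (List.ofFn fun i : Fin k => (ak (i.1 + 1), Bk (i.1 + 1)))

/-- Rule for player I's k-th move: `A_{k+1} ∈ [a_k, B_k]`. -/
def ruleI (na : ℕ) (ak : ℕ → α) (Bk : ℕ → R) (A : ℕ → R) (k : ℕ) : Prop :=
  A k ∈ S.seg (ak k) (na + k) (Bk k)

/-- Rule for player II's k-th move: `a_k ⊏ a_{k+1}`, `|a_{k+1}| = |a_k| + 1` and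
`B_{k+1} ∈ [a_{k+1}, A_{k+1}]`. -/
def ruleII (na : ℕ) (ak : ℕ → α) (Bk : ℕ → R) (A : ℕ → R) (k : ℕ) : Prop :=
  (∃ C : R, S.r C (na + k) = ak k ∧ S.r C (na + k + 1) = ak (k + 1)) ∧
  ak k ≠ ak (k + 1) ∧
  Bk (k + 1) ∈ S.seg (ak (k + 1)) (na + k + 1) (A k)

/-- The outcome `B∞`, determined by `{B∞} = ⋂ₖ [a_k]`, belongs to `X`. -/
def limitMem (na : ℕ) (ak : ℕ → α) (X : Set R) : Prop :=
  ∀ Binf : R, ({Binf} : Set R) = ⋂ k : ℕ, {Y : R | S.r Y (na + k) = ak k} → Binf ∈ X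

/-- `σ` is a winning strategy for player I in `𝒢_{[a,B₀]}(𝒳)`: it plays legally at every
legal position consistent with it, and every legal play following it is won by player I. -/
def IWinning (X : Set R) (a : α) (na : ℕ) (B0 : R) (σ : List (α × R) → R) : Prop :=
  (∀ (ak : ℕ → α) (Bk : ℕ → R), ak 0 = a → Bk 0 = B0 → ∀ k : ℕ,
      (∀ i < k, S.ruleII na ak Bk (playI σ ak Bk) i) →
      S.ruleI na ak Bk (playI σ ak Bk) k) ∧
  (∀ (ak : ℕ → α) (Bk : ℕ → R), ak 0 = a → Bk 0 = B0 →
      (∀ k : ℕ, S.ruleI na ak Bk (playI σ ak Bk) k ∧ S.ruleII na ak Bk (playI σ ak Bk) k) →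
      S.limitMem na ak X)

/-- First components of player II's moves induced by a strategy `τ`. -/
def playIIa (a : α) (τ : List R → α × R) (A : ℕ → R) : ℕ → α
  | 0 => a
  | k + 1 => (τ (List.ofFn fun i : Fin (k + 1) => A i.1)).1

/-- Second components of player II's moves induced by a strategy `τ`. -/
def playIIB (B0 : R) (τ : List R → α × R) (A : ℕ → R) : ℕ → R
  | 0 => B0
  | k + 1 => (τ (List.ofFn fun i : Fin (k + 1) => A i.1)).2

/-- `τ` is a winning strategy for player II in `𝒢_{[a,B₀]}(𝒳)`: it plays legally at every
legal position consistent with it, and every legal play following it is won by player II. -/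
def IIWinning (X : Set R) (a : α) (na : ℕ) (B0 : R) (τ : List R → α × R) : Prop :=
  (∀ (A : ℕ → R) (k : ℕ),
      (∀ i ≤ k, S.ruleI na (playIIa a τ A) (playIIB B0 τ A) A i) →
      (∀ i < k, S.ruleII na (playIIa a τ A) (playIIB B0 τ A) A i) →
      S.ruleII na (playIIa a τ A) (playIIB B0 τ A) A k) ∧
  (∀ A : ℕ → R,
      (∀ k : ℕ, S.ruleI na (playIIa a τ A) (playIIB B0 τ A) A k ∧
        S.ruleII na (playIIa a τ A) (playIIB B0 τ A) A k) →
      ∀ Binf : R,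
        ({Binf} : Set R) = ⋂ k : ℕ, {Y : R | S.r Y (na + k) = playIIa a τ A k} →
        Binf ∉ X)

section

variable {S}

lemma lefin_depth {B : R} {b : α} (h : S.hasDepth B b) :
    S.lefin b (S.r B (S.depth B b)) := by
  classical
  have h' : ∃ n, S.lefin b (S.r B n) := h
  unfold depth
  rw [dif_pos h']
  exact @Nat.find_spec _ (Classical.decPred _) h'

lemma depth_le {B : R} {b : α} {n : ℕ} (h : S.lefin b (S.r B n)) : S.depth B b ≤ n := by
  classical
  have h' : ∃ n, S.lefin b (S.r B n) := ⟨n, h⟩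
  unfold depth
  rw [dif_pos h']
  exact @Nat.find_min' _ (Classical.decPred _) h' _ h

lemma seg_subset_seg {A B : R} {b : α} {n : ℕ} (h : S.le A B) :
    S.seg b n A ⊆ S.seg b n B :=
  fun _ hX => ⟨S.le_trans hX.1 h, hX.2⟩

namespace IsStrongTRS

lemma r_eq_of_le (hS : S.IsStrongTRS) {A B : R} {n k : ℕ} (h : S.r A n = S.r B n)
    (hk : k ≤ n) : S.r A k = S.r B k :=
  (hS.2.1.2.2 A B n n h).2 k hk

lemma length_unique (hS : S.IsStrongTRS) {a : α} {n m : ℕ} (hn : a ∈ S.ARn n)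
    (hm : a ∈ S.ARn m) : n = m := by
  obtain ⟨A, hA⟩ := hn
  obtain ⟨B, hB⟩ := hm
  exact (hS.2.1.2.2 A B n m (hA.trans hB.symm)).1

lemma lefin_r_self (hS : S.IsStrongTRS) (A : R) (n : ℕ) : S.lefin (S.r A n) (S.r A n) :=
  hS.2.2.1.1 _ ⟨A, n, rfl⟩

lemma hasDepth_r_of_le (hS : S.IsStrongTRS) {A B : R} (h : S.le A B) (n : ℕ) :
    S.hasDepth B (S.r A n) :=
  (hS.2.2.1.2.2.2.1 A B).1 h n

lemma hasDepth_of_mem_seg (hS : S.IsStrongTRS) {X B : R} {a : α} {n : ℕ}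
    (h : X ∈ S.seg a n B) : S.hasDepth B a :=
  h.2 ▸ hS.hasDepth_r_of_le h.1 n

lemma segN_trans (hS : S.IsStrongTRS) {A B C : R} {n m : ℕ} (hnm : n ≤ m)
    (h : B ∈ S.segN n A) (h' : C ∈ S.segN m B) : C ∈ S.segN n A :=
  ⟨S.le_trans h'.1 h.1, (hS.r_eq_of_le h'.2 hnm).trans h.2⟩

lemma hasDepth_segN (hS : S.IsStrongTRS) {A B : R} {b : α} {k : ℕ} (hb : S.hasDepth B b)
    (hk : S.depth B b ≤ k) (h : A ∈ S.segN k B) :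
    S.hasDepth A b ∧ S.depth A b = S.depth B b := by
  have e : S.r A (S.depth B b) = S.r B (S.depth B b) := hS.r_eq_of_le h.2 hk
  have hl : S.lefin b (S.r A (S.depth B b)) := e ▸ lefin_depth hb
  refine ⟨⟨_, hl⟩, le_antisymm (depth_le hl) (depth_le ?_)⟩
  have hle := depth_le hl
  rw [← hS.r_eq_of_le h.2 (hle.trans hk)]
  exact lefin_depth ⟨_, hl⟩

lemma seg_nonempty (hS : S.IsStrongTRS) {B : R} {a : α} {n : ℕ} (ha : a ∈ S.ARn n)
    (h : S.hasDepth B a) : (S.seg a n B).Nonempty := by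
  obtain ⟨X, hX⟩ := hS.2.2.2.1.1 a n ha B _ h le_rfl B ⟨S.le_refl B, rfl⟩
  exact ⟨X, hX.1⟩

lemma depth_r_mono (hS : S.IsStrongTRS) {A B : R} (h : S.le A B) {n m : ℕ} (hnm : n ≤ m) :
    S.depth B (S.r A n) ≤ S.depth B (S.r A m) := by
  obtain ⟨d, ⟨C, j, k, hjk, hj, hk⟩, hd⟩ := hS.2.2.1.2.2.2.2 (S.r A n) (S.r A m) _
    ⟨A, n, m, hnm, rfl, rfl⟩ (lefin_depth (hS.hasDepth_r_of_le h m))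
  obtain ⟨rfl, hr⟩ := hS.2.1.2.2 C B k _ hk
  exact (depth_le (by rwa [← hr j hjk, hj])).trans hjk

lemma depth_r_lt_succ (hS : S.IsStrongTRS) {A B : R} (h : S.le A B) (n : ℕ) :
    S.depth B (S.r A n) < S.depth B (S.r A (n + 1)) := by
  refine lt_of_le_of_ne (hS.depth_r_mono h n.le_succ) fun heq => ?_
  have hb := hS.hasDepth_r_of_le h n
  have hc := hS.hasDepth_r_of_le h (n + 1)
  obtain ⟨D, hD, hO⟩ := hS.2.2.2.2 (S.r A n) n ⟨A, rfl⟩ B hb {S.r A (n + 1)}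
    (by rintro _ rfl; exact ⟨A, rfl⟩)
  have hbD := hS.hasDepth_segN hb le_rfl hD
  have hcD := hS.hasDepth_segN hc heq.ge hD
  rcases hO with hO | hO
  · obtain ⟨X, hX, hlt⟩ := hS.2.2.2.1.1 (S.r A n) n ⟨A, rfl⟩ D (S.depth B (S.r A n)) hbD.1
      hbD.2.le D ⟨S.le_refl D, rfl⟩
    have hXA : S.r X (n + 1) = S.r A (n + 1) := hO ⟨X, hX, rfl⟩
    rw [hXA, hcD.2] at hlt
    exact absurd (hlt hcD.1) (by omega)
  · obtain ⟨Y, hY⟩ := hS.seg_nonempty (n := n + 1) ⟨A, rfl⟩ hcD.1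
    exact Set.eq_empty_iff_forall_notMem.1 hO _
      ⟨rfl, Y, ⟨hY.1, hS.r_eq_of_le hY.2 n.le_succ⟩, hY.2⟩

lemma le_depth_r (hS : S.IsStrongTRS) {A B : R} (h : S.le A B) (n : ℕ) :
    n ≤ S.depth B (S.r A n) := by
  induction n with
  | zero => exact Nat.zero_le _
  | succ n ih => exact ih.trans_lt (hS.depth_r_lt_succ h n)

/-- The usual amalgamation axiom A.3 (2) follows from strong amalgamation and A.4. -/
lemma exists_segN_seg_subset (hS : S.IsStrongTRS) {A B : R} {a : α} {n : ℕ}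
    (hAB : S.le A B) (h : (S.seg a n A).Nonempty) :
    ∃ A' ∈ S.segN (S.depth B a) B, S.seg a n A' ⊆ S.seg a n A := by
  obtain ⟨Z, hZA, rfl⟩ := h
  have hZB := S.le_trans hZA hAB
  have hZZ := hS.lefin_r_self Z n
  obtain ⟨B', hB', hsub⟩ := hS.2.2.2.1.2 (S.r Z n) n ⟨Z, rfl⟩ B Z _ hZB
    (hS.hasDepth_r_of_le hZB n) le_rfl ⟨n, hZZ⟩
    ((depth_le hZZ).trans (hS.le_depth_r hZB n))
  refine ⟨B', hB', fun X hX => ?_⟩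
  have hXB := S.le_trans hX.1 hB'.1
  have hlt := hS.depth_r_lt_succ hXB n
  rw [hX.2] at hlt
  have hXZ := (hsub ⟨hX, fun _ => hlt⟩).1
  exact ⟨S.le_trans hXZ.1 hZA, hXZ.2⟩

lemma exists_limit (hS : S.IsStrongTRS) (m : ℕ) (E : ℕ → R)
    (hE : ∀ i, E (i + 1) ∈ S.segN (m + i) (E i)) :
    ∃ B, ∀ i, B ∈ S.segN (m + i) (E i) := by
  have hstep : ∀ i j, i ≤ j → S.le (E j) (E i) ∧ S.r (E j) (m + i) = S.r (E i) (m + i) := by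
    intro i j hij
    induction j, hij using Nat.le_induction with
    | base => exact ⟨S.le_refl _, rfl⟩
    | succ j hij ih =>
      exact ⟨S.le_trans (hE j).1 ih.1,
        (hS.r_eq_of_le (hE j).2 (Nat.add_le_add_left hij m)).trans ih.2⟩
  have hstab : ∀ n j, n ≤ m + j → S.r (E j) n = S.r (E n) n := by
    intro n j hn
    rcases le_total j n with h | h
    · exact (hS.r_eq_of_le (hstep j n h).2 hn).symm
    · exact hS.r_eq_of_le (hstep n j h).2 (Nat.le_add_left n m)
  have hmem : (fun n => S.r (E n) n) ∈ {f : ℕ → α | ∃ A : R, ∀ n, f n = S.r A n} := by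
    let _ : TopologicalSpace α := ⊥
    have hc : IsClosed {f : ℕ → α | ∃ A : R, ∀ n, f n = S.r A n} := hS.1
    refine hc.mem_of_tendsto (b := Filter.atTop) (f := fun i n => S.r (E i) n)
      (tendsto_pi_nhds.2 fun n => ?_) (Filter.Eventually.of_forall fun i => ⟨E i, fun _ => rfl⟩)
    refine tendsto_const_nhds.congr' ?_
    filter_upwards [Filter.eventually_ge_atTop n] with i hi
    exact (hstab n i (hi.trans (Nat.le_add_left i m))).symm
  obtain ⟨B, hB⟩ := hmem
  have hrB : ∀ n j, n ≤ m + j → S.r B n = S.r (E j) n := fun n j hn =>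
    (hB n).symm.trans (hstab n j hn).symm
  refine ⟨B, fun i => ⟨(hS.2.2.1.2.2.2.1 B (E i)).2 fun n => ?_, hrB _ _ le_rfl⟩⟩
  rw [hrB n (max n i) (by omega)]
  exact hS.hasDepth_r_of_le (hstep i _ (le_max_right n i)).1 n

lemma exists_segN_forall_mem_finset (hS : S.IsStrongTRS) {Q : α → ℕ → Set R → Prop}
    (hmono : ∀ b n s t, s ⊆ t → Q b n t → Q b n s)
    (hdense : ∀ b n D, b ∈ S.ARn n → S.hasDepth D b →
      ∃ D', S.le D' D ∧ (S.seg b n D').Nonempty ∧ Q b n (S.seg b n D'))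
    (k : ℕ) (D : R) (F : Finset α) :
    ∃ D' ∈ S.segN k D, ∀ b ∈ F, ∀ n, b ∈ S.ARn n → S.hasDepth D b → S.depth D b = k →
      Q b n (S.seg b n D') := by
  classical
  induction F using Finset.induction_on with
  | empty => exact ⟨D, ⟨S.le_refl D, rfl⟩, fun _ hb => absurd hb (Finset.notMem_empty _)⟩
  | insert c F _ ih =>
    obtain ⟨D₁, hD₁, hF⟩ := ih
    have hkeep : ∀ D₂, S.le D₂ D₁ → ∀ b ∈ F, ∀ n, b ∈ S.ARn n → S.hasDepth D b →
        S.depth D b = k → Q b n (S.seg b n D₂) := fun D₂ h b hb n hn hd hk =>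
      hmono _ _ _ _ (seg_subset_seg h) (hF b hb n hn hd hk)
    by_cases hc : ∃ n, c ∈ S.ARn n ∧ S.hasDepth D c ∧ S.depth D c = k
    · obtain ⟨n, hn, hd, hk⟩ := hc
      have hd₁ := hS.hasDepth_segN hd hk.le hD₁
      obtain ⟨D₂, hle, hne, hQ⟩ := hdense c n D₁ hn hd₁.1
      obtain ⟨D₃, hD₃, hsub⟩ := hS.exists_segN_seg_subset hle hne
      rw [hd₁.2, hk] at hD₃
      refine ⟨D₃, hS.segN_trans le_rfl hD₁ hD₃, fun b hb n' hn' hd' hk₂ => ?_⟩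
      rcases Finset.mem_insert.1 hb with rfl | hb
      · obtain rfl := hS.length_unique hn hn'
        exact hmono _ _ _ _ hsub hQ
      · exact hkeep D₃ hD₃.1 b hb n' hn' hd' hk₂
    · refine ⟨D₁, hD₁, fun b hb n' hn' hd' hk₂ => ?_⟩
      rcases Finset.mem_insert.1 hb with rfl | hb
      · exact absurd ⟨n', hn', hd', hk₂⟩ hc
      · exact hF b hb n' hn' hd' hk₂

/-- Fusion: a hereditary property of basic sets which can be achieved densely holds
simultaneously for all `[b, B]` with `depth_B(b) ≥ m`, for some `B ∈ [m, A]`. -/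
lemma fusion (hS : S.IsStrongTRS) {Q : α → ℕ → Set R → Prop}
    (hmono : ∀ b n s t, s ⊆ t → Q b n t → Q b n s)
    (hdense : ∀ b n D, b ∈ S.ARn n → S.hasDepth D b →
      ∃ D', S.le D' D ∧ (S.seg b n D').Nonempty ∧ Q b n (S.seg b n D'))
    (m : ℕ) (A : R) :
    ∃ B ∈ S.segN m A, ∀ b n, b ∈ S.ARn n → S.hasDepth B b → m ≤ S.depth B b →
      Q b n (S.seg b n B) := by
  have hstage : ∀ (k : ℕ) (D : R), ∃ D' ∈ S.segN k D, ∀ b n, b ∈ S.ARn n → S.hasDepth D b →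
      S.depth D b = k → Q b n (S.seg b n D') := by
    intro k D
    have hfin := hS.2.2.1.2.2.1 (S.r D k)
    obtain ⟨D', hD', h⟩ :=
      hS.exists_segN_forall_mem_finset hmono hdense k D hfin.toFinset
    refine ⟨D', hD', fun b n hn hd hk => h b ?_ n hn hd hk⟩
    rw [Set.Finite.mem_toFinset]
    exact hk ▸ lefin_depth hd
  choose next hnext hQ using hstage
  let E : ℕ → R := fun i => Nat.rec A (fun i D => next (m + i) D) i
  obtain ⟨B, hB⟩ := hS.exists_limit m E fun i => hnext (m + i) (E i)
  refine ⟨B, hB 0, fun b n hn hd hm => ?_⟩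
  obtain ⟨i, hi⟩ := Nat.exists_eq_add_of_le hm
  have hEB : S.r (E i) (m + i) = S.r B (m + i) := (hB i).2.symm
  have hlE : S.lefin b (S.r (E i) (m + i)) := by
    rw [hEB, ← hi]
    exact lefin_depth hd
  have hE := hS.hasDepth_segN ⟨_, hlE⟩ (depth_le hlE) (hB i)
  exact hmono _ _ _ _ (seg_subset_seg (hB (i + 1)).1)
    (hQ (m + i) (E i) b n hn ⟨_, hlE⟩ (hE.2.symm.trans hi))

/-- Combinatorial forcing: `[b, D]` can be refined so that either no or every `Z ∈ [b, D']`
is such that `[b, Z]` meets `X`. -/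
lemma exists_le_decides (hS : S.IsStrongTRS) (X : Set R) {b : α} {n : ℕ} {D : R}
    (hb : b ∈ S.ARn n) (hd : S.hasDepth D b) :
    ∃ D', S.le D' D ∧ (S.seg b n D').Nonempty ∧
      ((∀ Z ∈ S.seg b n D', ¬ (S.segN n Z ∩ X).Nonempty) ∨
        ∀ Z ∈ S.seg b n D', (S.segN n Z ∩ X).Nonempty) := by
  by_cases hg : ∃ Z ∈ S.seg b n D, ¬ (S.segN n Z ∩ X).Nonempty
  · obtain ⟨Z, ⟨hZD, rfl⟩, hZ⟩ := hg
    refine ⟨Z, hZD, ⟨Z, S.le_refl Z, rfl⟩, Or.inl fun Z' hZ' => ?_⟩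
    rintro ⟨Y, hY, hYX⟩
    exact hZ ⟨Y, ⟨S.le_trans hY.1 hZ'.1, hY.2.trans hZ'.2⟩, hYX⟩
  · push Not at hg
    exact ⟨D, S.le_refl D, hS.seg_nonempty hb hd, Or.inr hg⟩

/-- `[b, D]` can be refined so that either no `[b, Z]` with `Z ∈ [b, D']` meets `X`, or every
`[c, Z]` with `Z ∈ [b, D']` and `c` the initial segment of `Z` of length `|b| + 1` does. -/
lemma exists_le_forces (hS : S.IsStrongTRS) (X : Set R) {b : α} {n : ℕ} {D : R}
    (hb : b ∈ S.ARn n) (hd : S.hasDepth D b) :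
    ∃ D', S.le D' D ∧ (S.seg b n D').Nonempty ∧
      ((∀ Z ∈ S.seg b n D', ¬ (S.segN n Z ∩ X).Nonempty) ∨
        ∀ Z ∈ S.seg b n D', (S.segN (n + 1) Z ∩ X).Nonempty) := by
  obtain ⟨D₀, hD₀, hne₀, hg | hg⟩ := hS.exists_le_decides X hb hd
  · exact ⟨D₀, hD₀, hne₀, Or.inl hg⟩
  have hd₀ : S.hasDepth D₀ b := hne₀.elim fun _ h => hS.hasDepth_of_mem_seg h
  obtain ⟨D₁, hD₁, hdec⟩ := hS.fusion
    (Q := fun _ k s => (∀ Z ∈ s, ¬ (S.segN k Z ∩ X).Nonempty) ∨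
      ∀ Z ∈ s, (S.segN k Z ∩ X).Nonempty)
    (fun _ _ _ _ hst => Or.imp (fun h Z hZ => h Z (hst hZ)) (fun h Z hZ => h Z (hst hZ)))
    (fun _ _ _ hc hd => hS.exists_le_decides X hc hd) (S.depth D₀ b) D₀
  have hd₁ := hS.hasDepth_segN hd₀ le_rfl hD₁
  obtain ⟨D₂, hD₂, hO⟩ := hS.2.2.2.2 b n hb D₁ hd₁.1
    {c | c ∈ S.ARn (n + 1) ∧ ∀ Z ∈ S.seg c (n + 1) D₁, (S.segN (n + 1) Z ∩ X).Nonempty}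
    fun c hc => hc.1
  have hd₂ := hS.hasDepth_segN hd₁.1 le_rfl hD₂
  refine ⟨D₂, S.le_trans (S.le_trans hD₂.1 hD₁.1) hD₀, hS.seg_nonempty hb hd₂.1, Or.inr fun Z hZ => ?_⟩
  rcases hO with hO | hO
  · exact (hO ⟨Z, hZ, rfl⟩).2 Z ⟨S.le_trans hZ.1 hD₂.1, rfl⟩
  · exfalso
    obtain ⟨Y, hYZ, hYX⟩ :=
      hg Z ⟨S.le_trans hZ.1 (S.le_trans hD₂.1 hD₁.1), hZ.2⟩
    have hYb : S.r Y n = b := hYZ.2.trans hZ.2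
    have hYD₂ : S.le Y D₂ := S.le_trans hYZ.1 hZ.1
    have hYD₁ : S.le Y D₁ := S.le_trans hYD₂ hD₂.1
    have hdepth : S.depth D₀ b ≤ S.depth D₁ (S.r Y (n + 1)) := by
      rw [← hd₁.2, ← hYb]
      exact hS.depth_r_mono hYD₁ n.le_succ
    rcases hdec (S.r Y (n + 1)) (n + 1) ⟨Y, rfl⟩ (hS.hasDepth_r_of_le hYD₁ _) hdepth with h | h
    · exact h Y ⟨hYD₁, rfl⟩ ⟨Y, ⟨S.le_refl Y, rfl⟩, hYX⟩
    · exact Set.eq_empty_iff_forall_notMem.1 hO _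
        ⟨⟨⟨Y, rfl⟩, h⟩, Y, ⟨hYD₂, hYb⟩, rfl⟩

lemma ramseyNull_of_nwdB (hS : S.IsStrongTRS) {X : Set R} (hX : S.NwdB X) :
    S.RamseyNull X := by
  rintro a na A ha ⟨W, hW⟩
  have hdA := hS.hasDepth_of_mem_seg hW
  obtain ⟨B, hB, hQ⟩ := hS.fusion
    (Q := fun _ k s => (∀ Z ∈ s, ¬ (S.segN k Z ∩ X).Nonempty) ∨
      ∀ Z ∈ s, (S.segN (k + 1) Z ∩ X).Nonempty)
    (fun _ _ _ _ hst => Or.imp (fun h Z hZ => h Z (hst hZ)) (fun h Z hZ => h Z (hst hZ)))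
    (fun _ _ _ hb hd => hS.exists_le_forces X hb hd) (S.depth A a) A
  have hdB := hS.hasDepth_segN hdA le_rfl hB
  have hne := hS.seg_nonempty ha hdB.1
  rcases hQ a na ha hdB.1 hdB.2.ge with h | h
  · obtain ⟨Z, hZ⟩ := hne
    have hZX := Set.not_nonempty_iff_eq_empty.1 (h Z hZ)
    rw [segN, hZ.2] at hZX
    exact ⟨Z, ⟨S.le_trans hZ.1 hB.1, hZ.2⟩, hZX⟩
  · exfalso
    have hall : ∀ n, na + 1 ≤ n → ∀ Z ∈ S.seg a na B, (S.segN n Z ∩ X).Nonempty := by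
      intro n hn
      induction n, hn using Nat.le_induction with
      | base => exact h
      | succ n hn ih =>
        intro Z hZ
        have hdepth : S.depth A a ≤ S.depth B (S.r Z n) := by
          rw [← hdB.2]
          have := hS.depth_r_mono hZ.1 (Nat.le_of_succ_le hn)
          rwa [hZ.2] at this
        rcases hQ (S.r Z n) n ⟨Z, rfl⟩ (hS.hasDepth_r_of_le hZ.1 n) hdepth with h | h
        · exact absurd (ih Z hZ) (h Z ⟨hZ.1, rfl⟩)
        · exact h Z ⟨hZ.1, rfl⟩
    obtain ⟨_, ⟨c, nc, C, -, rfl⟩, ⟨Y, hY⟩, hsub, hdisj⟩ := hX _ ⟨a, na, B, ha, rfl⟩ hne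
    obtain ⟨Z, hZ, hZX⟩ := hall (max (na + 1) nc) (le_max_left _ _) Y (hsub hY)
    exact Set.eq_empty_iff_forall_notMem.1 hdisj Z
      ⟨⟨S.le_trans hZ.1 hY.1, (hS.r_eq_of_le hZ.2 (le_max_right _ _)).trans hY.2⟩, hZX⟩

lemma ramseyNull_iUnion (hS : S.IsStrongTRS) {f : ℕ → Set R}
    (hf : ∀ i, S.RamseyNull (f i)) : S.RamseyNull (⋃ i, f i) := by
  have hfin : ∀ b n D, b ∈ S.ARn n → S.hasDepth D b → ∀ N : ℕ,
      ∃ D', S.le D' D ∧ (S.seg b n D').Nonempty ∧ ∀ i < N, S.seg b n D' ∩ f i = ∅ := by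
    intro b n D hb hd N
    induction N with
    | zero => exact ⟨D, S.le_refl D, hS.seg_nonempty hb hd, by simp⟩
    | succ N ih =>
      obtain ⟨D₁, hD₁, hne, h⟩ := ih
      obtain ⟨D₂, hD₂, h₂⟩ := hf N b n D₁ hb hne
      refine ⟨D₂, S.le_trans hD₂.1 hD₁, ⟨D₂, S.le_refl D₂, hD₂.2⟩, fun i hi => ?_⟩
      rcases Nat.lt_succ_iff_lt_or_eq.1 hi with hi | rfl
      · refine Set.eq_empty_iff_forall_notMem.2 fun Y hY => ?_
        exact Set.eq_empty_iff_forall_notMem.1 (h i hi) Y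
          ⟨⟨S.le_trans hY.1.1 hD₂.1, hY.1.2⟩, hY.2⟩
      · exact h₂
  rintro a na A ha ⟨W, hW⟩
  have hdA := hS.hasDepth_of_mem_seg hW
  obtain ⟨B, hB, hQ⟩ := hS.fusion (Q := fun _ n s => ∀ i < n + 1, s ∩ f i = ∅)
    (fun _ _ _ _ hst h i hi =>
      Set.subset_eq_empty (Set.inter_subset_inter_left _ hst) (h i hi))
    (fun b n D hb hd => hfin b n D hb hd (n + 1)) (S.depth A a) A
  have hdB := hS.hasDepth_segN hdA le_rfl hB
  obtain ⟨Z, hZ⟩ := hS.seg_nonempty ha hdB.1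
  refine ⟨Z, ⟨S.le_trans hZ.1 hB.1, hZ.2⟩, Set.eq_empty_iff_forall_notMem.2 ?_⟩
  rintro Y ⟨hY, hYf⟩
  obtain ⟨i, hi⟩ := Set.mem_iUnion.1 hYf
  have hYB : S.le Y B := S.le_trans hY.1 hZ.1
  have hdepth : S.depth A a ≤ S.depth B (S.r Y (max na i)) := by
    rw [← hdB.2, ← hY.2]
    exact hS.depth_r_mono hYB (le_max_left _ _)
  exact Set.eq_empty_iff_forall_notMem.1
    (hQ (S.r Y (max na i)) (max na i) ⟨Y, rfl⟩ (hS.hasDepth_r_of_le hYB _) hdepth i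
      (Nat.lt_succ_of_le (le_max_right _ _))) Y ⟨⟨hYB, rfl⟩, hi⟩

end IsStrongTRS

lemma RamseyNull.nwdB {X : Set R} (hX : S.RamseyNull X) : S.NwdB X := by
  rintro _ ⟨a, na, A, ha, rfl⟩ hne
  obtain ⟨B, hB, h⟩ := hX a na A ha hne
  exact ⟨_, ⟨a, na, B, ha, rfl⟩, ⟨B, S.le_refl B, hB.2⟩,
    seg_subset_seg hB.1, h⟩

end

/-- In a strong topological Ramsey space with its Ellentuck topology, for any
`𝒳 ⊆ ℛ`: `𝒳` is Ramsey null iff `𝒳` is nowhere dense iff `𝒳` is meager. -/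
theorem ramsey_null_iff_nwd_iff_meager (S : CombStruct R α) (hS : S.IsStrongTRS)
    (X : Set R) :
    (S.RamseyNull X ↔ S.NwdB X) ∧ (S.NwdB X ↔ S.MeagerB X) := by
  refine ⟨⟨RamseyNull.nwdB, hS.ramseyNull_of_nwdB⟩,
    fun h => ⟨fun _ => X, fun _ => h, (Set.iUnion_const X).symm⟩, ?_⟩
  rintro ⟨f, hf, rfl⟩
  exact (hS.ramseyNull_iUnion fun i => hS.ramseyNull_of_nwdB (hf i)).nwdB

end CombStruct
end AbstractTRS
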